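/- arXiv:2305.09611 — 3 statements merged into one kernel-verified Lean document; each statement's English description precedes it below -/
import Mathlib

section
/- (Ellentuck's theorem, part 2.) Let [ℕ]^ω carry the Ellentuck topology. For any set 𝒜 ⊆ [ℕ]^ω the following are equivalent: (a) 𝒜 is Ramsey; (b) 𝒜 has the abstract Baire property with respect to the Ellentuck basic open sets; (c) 𝒜 has the Baire property in the Ellentuck topology. -/
open scoped Topology

namespace Ellentuck

/-- `[ℕ]^ω`, the set of infinite subsets of `ℕ`. -/
abbrev InfSet : Type := {A : Set ℕ // A.Infinite}

/-- `s ⊏ A` : the finite set `s` is an initial segment of `A`,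
i.e. `s = {n ∈ A : n ≤ max s}` (which for `s = ∅` says `s = ∅`). -/
def InitSeg (s : Finset ℕ) (A : Set ℕ) : Prop :=
  (s : Set ℕ) = {n | n ∈ A ∧ (n : WithBot ℕ) ≤ s.max}

/-- The Ellentuck basic set `[s, B] = {A ∈ [ℕ]^ω : A ⊆ B ∧ s ⊏ A}`. -/
def seg (s : Finset ℕ) (B : InfSet) : Set InfSet :=
  {A | A.1 ⊆ B.1 ∧ InitSeg s A.1}

/-- Basic open sets of the Ellentuck topology. -/
def IsBasic (U : Set InfSet) : Prop := ∃ (s : Finset ℕ) (B : InfSet), U = seg s B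

/-- The Ellentuck topology on `[ℕ]^ω`, generated by the sets `[s,B]`. -/
def ellentuckTop : TopologicalSpace InfSet :=
  TopologicalSpace.generateFrom {U | IsBasic U}

/-- `𝒩` is nowhere dense: every nonempty basic open set contains a nonempty basic open
subset disjoint from `𝒩`. -/
def Nwd (X : Set InfSet) : Prop :=
  ∀ U : Set InfSet, IsBasic U → U.Nonempty →
    ∃ V : Set InfSet, IsBasic V ∧ V.Nonempty ∧ V ⊆ U ∧ V ∩ X = ∅

/-- `𝒳` is meager: a countable union of nowhere dense sets. -/
def Meager (X : Set InfSet) : Prop :=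
  ∃ f : ℕ → Set InfSet, (∀ i, Nwd (f i)) ∧ X = ⋃ i, f i

/-- `𝒳` has the abstract Baire property. -/
def ABP (X : Set InfSet) : Prop :=
  ∀ U : Set InfSet, IsBasic U → U.Nonempty →
    ∃ V : Set InfSet, IsBasic V ∧ V.Nonempty ∧ V ⊆ U ∧ (V ⊆ X ∨ V ∩ X = ∅)

/-- `𝒳` has the Baire property: `𝒳 △ 𝒪` is meager for some open set `𝒪` of the
Ellentuck topology. -/
def BP (X : Set InfSet) : Prop :=
  ∃ O : Set InfSet, IsOpen[ellentuckTop] O ∧ Meager (symmDiff X O)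

/-- `𝒜 ⊆ [ℕ]^ω` is Ramsey. -/
def IsRamsey (X : Set InfSet) : Prop :=
  ∀ (N : InfSet) (s : Finset ℕ), (s : Set ℕ) ⊆ N.1 →
    ∃ M : InfSet, M.1 ⊆ N.1 ∧ (s : Set ℕ) ⊆ M.1 ∧ (seg s M ⊆ X ∨ seg s M ∩ X = ∅)

/-- `𝒜 ⊆ [ℕ]^ω` is Ramsey null. -/
def IsRamseyNull (X : Set InfSet) : Prop :=
  ∀ (N : InfSet) (s : Finset ℕ), (s : Set ℕ) ⊆ N.1 →
    ∃ M : InfSet, M.1 ⊆ N.1 ∧ (s : Set ℕ) ⊆ M.1 ∧ seg s M ∩ X = ∅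

/-- The infinite sets that end-extend the finite set `s` by elements of `M`. -/
def cone (s : Finset ℕ) (M : Set ℕ) : Set InfSet :=
  {A | (s : Set ℕ) ⊆ A.1 ∧ ∀ n ∈ A.1, n ∉ s → n ∈ M ∧ ∀ y ∈ s, y < n}

theorem initSeg_iff (s : Finset ℕ) (A : Set ℕ) :
    InitSeg s A ↔ (s : Set ℕ) ⊆ A ∧ ∀ n ∈ A, n ∉ s → ∀ y ∈ s, y < n := by
  unfold InitSeg
  constructor
  · intro h
    have h' : ∀ n, n ∈ s ↔ n ∈ A ∧ (n : WithBot ℕ) ≤ s.max := fun n => by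
      simpa using Set.ext_iff.1 h n
    refine ⟨fun n hn => ((h' n).1 hn).1, fun n hn hns y hy => ?_⟩
    by_contra hle
    exact hns ((h' n).2 ⟨hn, le_trans (WithBot.coe_le_coe.2 (not_lt.1 hle)) (Finset.le_max hy)⟩)
  · rintro ⟨h₁, h₂⟩
    ext n
    simp only [Finset.mem_coe, Set.mem_ofPred_eq]
    refine ⟨fun hn => ⟨h₁ hn, Finset.le_max hn⟩, fun ⟨hn, hle⟩ => ?_⟩
    by_contra hns
    have hs : s.Nonempty := by
      rw [Finset.nonempty_iff_ne_empty]
      rintro rfl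
      simp at hle
    rw [← Finset.coe_max' hs] at hle
    exact absurd (h₂ n hn hns _ (s.max'_mem hs)) (not_lt.2 (WithBot.coe_le_coe.1 hle))

theorem seg_eq_cone {s : Finset ℕ} {B : InfSet} {M : Set ℕ} (h : B.1 = (s : Set ℕ) ∪ M) :
    seg s B = cone s M := by
  ext A
  simp only [seg, cone, initSeg_iff, Set.mem_ofPred_eq, h]
  constructor
  · rintro ⟨h₁, h₂, h₃⟩
    exact ⟨h₂, fun n hn hns => ⟨(h₁ hn).resolve_left hns, h₃ n hn hns⟩⟩
  · rintro ⟨h₁, h₂⟩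
    refine ⟨fun n hn => ?_, h₁, fun n hn hns => (h₂ n hn hns).2⟩
    by_cases hns : n ∈ s
    · exact Or.inl hns
    · exact Or.inr (h₂ n hn hns).1

theorem cone_nonempty (s : Finset ℕ) {M : Set ℕ} (hM : M.Infinite) : (cone s M).Nonempty := by
  have hinf : (M \ {n | n ≤ s.sup id}).Infinite := hM.sdiff (Set.finite_Iic _)
  refine ⟨⟨s ∪ (M \ {n | n ≤ s.sup id}), hinf.mono Set.subset_union_right⟩,
    Set.subset_union_left, fun n hn hns => ?_⟩
  obtain ⟨h₁, h₂⟩ := hn.resolve_left hns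
  refine ⟨h₁, fun y hy => ?_⟩
  have : y ≤ s.sup id := Finset.le_sup (f := id) hy
  simp only [Set.mem_ofPred_eq] at h₂
  omega

theorem isBasic_cone (s : Finset ℕ) {M : Set ℕ} (hM : M.Infinite) : IsBasic (cone s M) :=
  ⟨s, ⟨s ∪ M, hM.mono Set.subset_union_right⟩, (seg_eq_cone rfl).symm⟩

theorem IsBasic.exists_eq_cone {U : Set InfSet} (hU : IsBasic U) (hne : U.Nonempty) :
    ∃ (s : Finset ℕ) (M : InfSet), U = cone s M.1 := by
  obtain ⟨s, B, rfl⟩ := hU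
  obtain ⟨A, hA⟩ := hne
  exact ⟨s, B, seg_eq_cone
    (Set.union_eq_self_of_subset_left ((((initSeg_iff s A.1).1 hA.2).1).trans hA.1)).symm⟩

theorem isRamsey_iff (X : Set InfSet) :
    IsRamsey X ↔ ∀ (s : Finset ℕ) (N : InfSet),
      ∃ M : InfSet, M.1 ⊆ N.1 ∧ (cone s M.1 ⊆ X ∨ cone s M.1 ∩ X = ∅) := by
  constructor
  · intro h s N
    obtain ⟨M, hMN, hsM, hM⟩ := h ⟨s ∪ N.1, N.2.mono Set.subset_union_right⟩ s
      Set.subset_union_left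
    rw [seg_eq_cone (M := M.1 \ s) (Set.union_sdiff_cancel hsM).symm] at hM
    refine ⟨⟨M.1 \ s, M.2.sdiff s.finite_toSet⟩, fun n hn => ?_, hM⟩
    exact (hMN hn.1).resolve_left hn.2
  · intro h N s hs
    obtain ⟨M, hMN, hM⟩ := h s N
    refine ⟨⟨s ∪ M.1, M.2.mono Set.subset_union_right⟩, Set.union_subset hs hMN,
      Set.subset_union_left, ?_⟩
    rwa [seg_eq_cone rfl]

theorem cone_mono {s : Finset ℕ} {K L : Set ℕ} (h : L ∩ {n | ∀ y ∈ s, y < n} ⊆ K) :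
    cone s L ⊆ cone s K :=
  fun _ hA => ⟨hA.1, fun n hn hns => ⟨h (hA.2 n hn hns), (hA.2 n hn hns).2⟩⟩

theorem infinite_inter_above {M : Set ℕ} (hM : M.Infinite) (s : Finset ℕ) :
    (M ∩ {n | ∀ y ∈ s, y < n}).Infinite := by
  refine (hM.sdiff (Set.finite_Iic (s.sup id))).mono fun n hn => ⟨hn.1, fun y hy => ?_⟩
  have h₁ : y ≤ s.sup id := Finset.le_sup (f := id) hy
  have h₂ := hn.2
  simp only [Set.mem_Iic] at h₂
  omega

/-- The elements of `A` up to `m`, as a finite set. -/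
noncomputable def upTo (A : Set ℕ) (m : ℕ) : Finset ℕ :=
  ((Set.finite_Iic m).subset (Set.inter_subset_right : A ∩ Set.Iic m ⊆ Set.Iic m)).toFinset

@[simp] theorem mem_upTo {A : Set ℕ} {m n : ℕ} : n ∈ upTo A m ↔ n ∈ A ∧ n ≤ m := by
  simp [upTo]

theorem mem_cone_upTo {s : Finset ℕ} {M : Set ℕ} {A : InfSet} (hA : A ∈ cone s M) {m : ℕ}
    (hm : ∀ y ∈ s, y ≤ m) : A ∈ cone (upTo A.1 m) M := by
  refine ⟨fun n hn => (mem_upTo.1 hn).1, fun n hn hnm => ?_⟩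
  have hlt : m < n := by simpa [hn] using hnm
  refine ⟨(hA.2 n hn fun hns => ?_).1, fun y hy => (mem_upTo.1 hy).2.trans_lt hlt⟩
  exact absurd (hm n hns) (not_le.2 hlt)

theorem upTo_subset {s : Finset ℕ} {M : Set ℕ} {A : InfSet} (hA : A ∈ cone s M) (m : ℕ) :
    (upTo A.1 m : Set ℕ) ⊆ s ∪ M := by
  intro n hn
  by_cases hns : n ∈ s
  · exact Or.inl hns
  · exact Or.inr (hA.2 n (mem_upTo.1 hn).1 hns).1

theorem exists_subset_forall_finset {ι : Type*} {Q : ι → Set ℕ → Prop}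
    (mono : ∀ i K L, L ⊆ K → Q i K → Q i L)
    (I : Finset ι) (dense : ∀ i ∈ I, ∀ K : InfSet, ∃ L : InfSet, L.1 ⊆ K.1 ∧ Q i L.1)
    (K : InfSet) : ∃ L : InfSet, L.1 ⊆ K.1 ∧ ∀ i ∈ I, Q i L.1 := by
  classical
  induction I using Finset.induction_on with
  | empty => exact ⟨K, subset_rfl, by simp⟩
  | insert i I _ ih =>
    obtain ⟨L, hLK, hL⟩ := ih fun j hj => dense j (Finset.mem_insert_of_mem hj)
    obtain ⟨L', hLL, hL'⟩ := dense i (Finset.mem_insert_self i I) L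
    refine ⟨L', hLL.trans hLK, fun j hj => ?_⟩
    obtain rfl | hj := Finset.mem_insert.1 hj
    · exact hL'
    · exact mono j _ _ hLL (hL j hj)

/-- Fusion: a property `P t M` that depends only on the part of `M` above `t`, is hereditary and
can be achieved for each `t` separately can be achieved for all `t ⊆ s ∪ M` at once. -/
theorem exists_fusion {P : Finset ℕ → Set ℕ → Prop}
    (mono : ∀ t K L, L ∩ {n | ∀ y ∈ t, y < n} ⊆ K → P t K → P t L)
    (dense : ∀ t (K : InfSet), ∃ L : InfSet, L.1 ⊆ K.1 ∧ P t L.1) (s : Finset ℕ) (N : InfSet) :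
    ∃ M : InfSet, M.1 ⊆ N.1 ∧ ∀ t : Finset ℕ, (t : Set ℕ) ⊆ s ∪ M.1 → P t M.1 := by
  have step (n : ℕ) (K : InfSet) :
      ∃ L : InfSet, L.1 ⊆ K.1 ∧ ∀ t ∈ (Finset.range (n + 1)).powerset, P t L.1 :=
    exists_subset_forall_finset
      (fun t K L h => mono t K L (Set.inter_subset_left.trans h)) _ (fun t _ => dense t) K
  choose F hFsub hFP using step
  let D : ℕ → InfSet := fun n => Nat.rec (F 0 N) (fun k K => F (k + 1) K) n
  have hDanti : Antitone fun n => (D n).1 := antitone_nat_of_succ_le fun n => hFsub (n + 1) (D n)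
  have hDP (n : ℕ) (t : Finset ℕ) (ht : ∀ y ∈ t, y ≤ n) : P t (D n).1 := by
    have ht' : t ∈ (Finset.range (n + 1)).powerset := by
      rw [Finset.mem_powerset]
      exact fun y hy => Finset.mem_range.2 (Nat.lt_succ_of_le (ht y hy))
    cases n with
    | zero => exact hFP 0 N t ht'
    | succ n => exact hFP (n + 1) (D n) t ht'
  choose f hfD hfgt using fun n => (D n).2.exists_gt n
  let m : ℕ → ℕ := fun k => f^[k] (s.sup id)
  have hmsucc (k : ℕ) : m (k + 1) = f (m k) := Function.iterate_succ_apply' f k _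
  have hmmono : StrictMono m := strictMono_nat_of_lt_succ fun k => by
    rw [hmsucc]
    exact hfgt _
  have htail (j k : ℕ) (h : j ≤ k) : m (k + 1) ∈ (D (m j)).1 := by
    rw [hmsucc]
    exact hDanti (hmmono.monotone h) (hfD _)
  refine ⟨⟨Set.range fun k => m (k + 1), Set.infinite_range_of_injective
    fun i j h => Nat.succ_injective (hmmono.injective h)⟩, ?_, fun t ht => ?_⟩
  · rintro _ ⟨k, rfl⟩
    exact hFsub 0 N (hDanti (Nat.zero_le _) (htail k k le_rfl))
  · by_cases hts : ∀ y ∈ t, y ≤ s.sup id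
    · refine mono t _ _ ?_ (hDP _ t hts)
      rintro _ ⟨⟨k, rfl⟩, -⟩
      exact htail 0 k (Nat.zero_le k)
    · push Not at hts
      obtain ⟨y, hyt, hy⟩ := hts
      have hne : t.Nonempty := ⟨y, hyt⟩
      have hmax : s.sup id < t.max' hne := hy.trans_le (t.le_max' y hyt)
      obtain ⟨k, hk⟩ : t.max' hne ∈ Set.range fun k => m (k + 1) :=
        (ht (t.max'_mem hne)).resolve_left fun h =>
          absurd (Finset.le_sup (f := id) h) (not_le.2 hmax)
      refine mono t _ _ ?_ (hDP (m (k + 1)) t fun z hz => (t.le_max' z hz).trans hk.ge)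
      rintro _ ⟨⟨j, rfl⟩, hj⟩
      have hlt : m (k + 1) < m (j + 1) := hk.trans_lt (hj _ (t.max'_mem hne))
      exact htail _ _ (by have := hmmono.lt_iff_lt.1 hlt; omega)

theorem IsOpen.exists_upTo {O : Set InfSet} (hO : IsOpen[ellentuckTop] O) {A : InfSet}
    (hA : A ∈ O) : ∃ m, ∀ C : InfSet, C.1 ⊆ A.1 → upTo C.1 m = upTo A.1 m → C ∈ O := by
  have hO' : TopologicalSpace.GenerateOpen {U | IsBasic U} O := hO
  clear hO
  induction hO' with
  | basic U hU =>
    obtain ⟨s, B, rfl⟩ := hU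
    obtain ⟨hAB, hs⟩ := hA
    rw [initSeg_iff] at hs
    refine ⟨s.sup id, fun C hCA hC => ⟨hCA.trans hAB, (initSeg_iff _ _).2
      ⟨fun n hn => ?_, fun n hn => hs.2 n (hCA hn)⟩⟩⟩
    have : n ∈ upTo A.1 (s.sup id) := mem_upTo.2 ⟨hs.1 hn, Finset.le_sup (f := id) hn⟩
    rw [← hC] at this
    exact (mem_upTo.1 this).1
  | univ => exact ⟨0, fun _ _ _ => trivial⟩
  | inter U V _ _ ihU ihV =>
    obtain ⟨m₁, h₁⟩ := ihU hA.1
    obtain ⟨m₂, h₂⟩ := ihV hA.2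
    have key (C : InfSet) (hC : upTo C.1 (max m₁ m₂) = upTo A.1 (max m₁ m₂)) (m : ℕ)
        (hm : m ≤ max m₁ m₂) : upTo C.1 m = upTo A.1 m := by
      ext n
      have := Finset.ext_iff.1 hC n
      simp only [mem_upTo] at this ⊢
      exact ⟨fun h => ⟨(this.1 ⟨h.1, h.2.trans hm⟩).1, h.2⟩,
        fun h => ⟨(this.2 ⟨h.1, h.2.trans hm⟩).1, h.2⟩⟩
    exact ⟨max m₁ m₂, fun C hCA hC => ⟨h₁ C hCA (key C hC _ (le_max_left _ _)),
      h₂ C hCA (key C hC _ (le_max_right _ _))⟩⟩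
  | sUnion S _ ih =>
    obtain ⟨U, hU, hAU⟩ := hA
    obtain ⟨m, hm⟩ := ih U hU hAU
    exact ⟨m, fun C hCA hC => ⟨U, hU, hm C hCA hC⟩⟩

/-- `M` rejects `s`: no infinite subset `L` of `M` satisfies `cone s L ⊆ X`. -/
def Rejects (X : Set InfSet) (s : Finset ℕ) (M : Set ℕ) : Prop :=
  ∀ L : InfSet, L.1 ⊆ M → ¬ cone s L.1 ⊆ X

theorem Rejects.mono {X : Set InfSet} {s : Finset ℕ} {K L : Set ℕ} (hK : Rejects X s K)
    (h : L ∩ {n | ∀ y ∈ s, y < n} ⊆ K) : Rejects X s L := fun M hM hX =>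
  hK ⟨_, infinite_inter_above M.2 s⟩ ((Set.inter_subset_inter_left _ hM).trans h)
    ((cone_mono (Set.inter_subset_left.trans Set.inter_subset_left)).trans hX)

/-- If every one-point extension of `s` by an element of `M` has its cone in `X`,
so does `s`. -/
theorem cone_subset_of_insert {X : Set InfSet} {s : Finset ℕ} {M : Set ℕ}
    (h : ∀ n ∈ M, (∀ y ∈ s, y < n) → cone (insert n s) M ⊆ X) : cone s M ⊆ X := by
  intro A hA
  have hne : ∃ n, n ∈ A.1 ∧ n ∉ s := (A.2.sdiff s.finite_toSet).nonempty
  classical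
  obtain ⟨hn, hns⟩ := Nat.find_spec hne
  have hmin (k : ℕ) (hk : k ∈ A.1) (hks : k ∉ s) : Nat.find hne ≤ k := Nat.find_min' hne ⟨hk, hks⟩
  generalize Nat.find hne = n at hn hns hmin
  obtain ⟨hnM, hlt⟩ := hA.2 n hn hns
  refine h n hnM hlt ⟨?_, fun k hk hks => ?_⟩
  · rw [Finset.coe_insert]
    exact Set.insert_subset hn hA.1
  · rw [Finset.mem_insert, not_or] at hks
    obtain ⟨hkM, hks'⟩ := hA.2 k hk hks.2
    refine ⟨hkM, fun y hy => ?_⟩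
    obtain rfl | hy := Finset.mem_insert.1 hy
    · exact lt_of_le_of_ne (hmin k hk hks.2) (Ne.symm hks.1)
    · exact hks' y hy

theorem exists_cone_subset_or_rejects_insert (X : Set InfSet) (t : Finset ℕ) (K : InfSet) :
    ∃ L : InfSet, L.1 ⊆ K.1 ∧ (cone t L.1 ⊆ X ∨
      ∀ n ∈ L.1, (∀ y ∈ t, y < n) → Rejects X (insert n t) L.1) := by
  by_cases hK : Rejects X t K.1
  · obtain ⟨M, hMK, hM⟩ := exists_fusion (P := fun u L => cone u L ⊆ X ∨ Rejects X u L)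
      (fun u K L h => Or.imp (cone_mono h).trans fun hr => hr.mono h)
      (fun u K => by
        by_cases hu : Rejects X u K.1
        · exact ⟨K, subset_rfl, Or.inr hu⟩
        · simp only [Rejects, not_forall, not_not] at hu
          obtain ⟨L, hLK, hL⟩ := hu
          exact ⟨L, hLK, Or.inl hL⟩) t K
    have hfin : {n | n ∈ M.1 ∧ cone (insert n t) M.1 ⊆ X}.Finite := by
      by_contra hinf
      refine hK ⟨_, hinf⟩ (fun n hn => hMK hn.1) (cone_subset_of_insert fun n hn _ => ?_)
      exact (cone_mono fun k hk => hk.1.1).trans hn.2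
    refine ⟨⟨_, M.2.sdiff hfin⟩, Set.sdiff_subset.trans hMK, Or.inr fun n hn _ => ?_⟩
    refine ((hM (insert n t) ?_).resolve_left fun h => hn.2 ⟨hn.1, h⟩).mono
      (Set.inter_subset_left.trans Set.sdiff_subset)
    rw [Finset.coe_insert]
    exact Set.insert_subset (Or.inr hn.1) Set.subset_union_left
  · simp only [Rejects, not_forall, not_not] at hK
    obtain ⟨L, hLK, hL⟩ := hK
    exact ⟨L, hLK, Or.inl hL⟩

theorem rejects_of_forall_insert {X : Set InfSet} {s : Finset ℕ} {M : Set ℕ}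
    (hs : Rejects X s M)
    (h : ∀ t : Finset ℕ, (t : Set ℕ) ⊆ s ∪ M → Rejects X t M →
      ∀ n ∈ M, (∀ y ∈ t, y < n) → Rejects X (insert n t) M)
    (t : Finset ℕ) (htM : (t : Set ℕ) ⊆ M) (hst : ∀ n ∈ t, ∀ y ∈ s, y < n) :
    Rejects X (s ∪ t) M := by
  induction t using Finset.induction_on_max with
  | empty => simpa using hs
  | insert n t hn ih =>
    rw [Finset.coe_insert] at htM
    have htM' : (t : Set ℕ) ⊆ M := (Set.subset_insert n _).trans htM
    rw [Finset.union_insert]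
    refine h _ ?_ (ih htM' fun k hk => hst k (Finset.mem_insert_of_mem hk)) n
      (htM (Set.mem_insert n _)) fun y hy => ?_
    · rw [Finset.coe_union]
      exact Set.union_subset_union_right _ htM'
    · obtain hy | hy := Finset.mem_union.1 hy
      · exact hst n (Finset.mem_insert_self n t) y hy
      · exact hn y hy

theorem isRamsey_of_isOpen {O : Set InfSet} (hO : IsOpen[ellentuckTop] O) : IsRamsey O := by
  rw [isRamsey_iff]
  intro s N
  by_cases hN : Rejects O s N.1
  swap
  · simp only [Rejects, not_forall, not_not] at hN
    obtain ⟨L, hLN, hL⟩ := hN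
    exact ⟨L, hLN, Or.inl hL⟩
  obtain ⟨M, hMN, hM⟩ := exists_fusion
    (P := fun t L => cone t L ⊆ O ∨ ∀ n ∈ L, (∀ y ∈ t, y < n) → Rejects O (insert n t) L)
    (fun t K L h => Or.imp (cone_mono h).trans fun hr n hn hlt =>
      (hr n (h ⟨hn, hlt⟩) hlt).mono fun k hk =>
        h ⟨hk.1, fun y hy => hk.2 y (Finset.mem_insert_of_mem hy)⟩)
    (exists_cone_subset_or_rejects_insert O) s N
  refine ⟨M, hMN, Or.inr (Set.eq_empty_of_forall_notMem fun A ⟨hA, hAO⟩ => ?_)⟩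
  obtain ⟨m, hm⟩ := IsOpen.exists_upTo hO hAO
  set k := max m (s.sup id)
  have hk (y : ℕ) (hy : y ∈ s) : y ≤ k := (Finset.le_sup (f := id) hy).trans (le_max_right _ _)
  have hrej : Rejects O (s ∪ (upTo A.1 k \ s)) M.1 := by
    refine rejects_of_forall_insert (hN.mono (Set.inter_subset_left.trans hMN))
      (fun t ht htr => (hM t ht).resolve_left (htr M subset_rfl)) _ (fun n hn => ?_)
      fun n hn => ?_
    all_goals
      simp only [Finset.coe_sdiff, Finset.mem_sdiff, Set.mem_sdiff, Finset.mem_coe, mem_upTo] at hn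
    · exact (hA.2 n hn.1.1 hn.2).1
    · exact (hA.2 n hn.1.1 hn.2).2
  have hsub : s ⊆ upTo A.1 k := fun y hy => mem_upTo.2 ⟨hA.1 hy, hk y hy⟩
  rw [Finset.union_sdiff_of_subset hsub] at hrej
  have hAk := mem_cone_upTo hA hk
  refine hrej ⟨_, A.2.sdiff (upTo A.1 k).finite_toSet⟩
    (fun n hn => (hAk.2 n hn.1 hn.2).1) fun C hC => hm C (fun n hn => ?_) ?_
  · by_cases hnk : n ∈ upTo A.1 k
    · exact (mem_upTo.1 hnk).1
    · exact (hC.2 n hn hnk).1.1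
  · ext n
    simp only [mem_upTo, and_congr_left_iff]
    intro hnm
    refine ⟨fun hn => ?_, fun hn => hC.1 (mem_upTo.2 ⟨hn, hnm.trans (le_max_left _ _)⟩)⟩
    by_cases hnk : n ∈ upTo A.1 k
    · exact (mem_upTo.1 hnk).1
    · exact (hC.2 n hn hnk).1.1

theorem abp_of_isRamsey {X : Set InfSet} (hX : IsRamsey X) : ABP X := by
  intro U hU hne
  obtain ⟨s, N, rfl⟩ := hU.exists_eq_cone hne
  obtain ⟨M, hMN, hM⟩ := (isRamsey_iff X).1 hX s N
  exact ⟨cone s M.1, isBasic_cone s M.2, cone_nonempty s M.2,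
    cone_mono (Set.inter_subset_left.trans hMN), hM⟩

/-- The union of the basic sets contained in `X`. -/
def basicInterior (X : Set InfSet) : Set InfSet := ⋃₀ {U | IsBasic U ∧ U ⊆ X}

theorem isOpen_basicInterior (X : Set InfSet) : IsOpen[ellentuckTop] (basicInterior X) :=
  .sUnion _ fun U hU => .basic U hU.1

theorem basicInterior_subset (X : Set InfSet) : basicInterior X ⊆ X :=
  Set.sUnion_subset fun _ hU => hU.2

theorem subset_basicInterior {X U : Set InfSet} (hU : IsBasic U) (h : U ⊆ X) :
    U ⊆ basicInterior X := Set.subset_sUnion_of_mem ⟨hU, h⟩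

theorem isRamsey_of_abp {X : Set InfSet} (hX : ABP X) : IsRamsey X := by
  rw [isRamsey_iff]
  intro s N
  obtain ⟨M, hMN, hM | hM⟩ :=
    (isRamsey_iff _).1 (isRamsey_of_isOpen (isOpen_basicInterior X)) s N
  · exact ⟨M, hMN, Or.inl (hM.trans (basicInterior_subset X))⟩
  obtain ⟨L, hLM, hL | hL⟩ :=
    (isRamsey_iff _).1 (isRamsey_of_isOpen (isOpen_basicInterior Xᶜ)) s M
  · refine ⟨L, hLM.trans hMN, Or.inr ?_⟩
    rw [← Set.disjoint_iff_inter_eq_empty, ← Set.subset_compl_iff_disjoint_right]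
    exact hL.trans (basicInterior_subset _)
  obtain ⟨V, hV, ⟨A, hA⟩, hVL, hVX⟩ := hX _ (isBasic_cone s L.2) (cone_nonempty s L.2)
  rw [← Set.disjoint_iff_inter_eq_empty, Set.disjoint_left] at hM hL
  obtain hVX | hVX := hVX
  · exact absurd (subset_basicInterior hV hVX hA)
      (hM (cone_mono (Set.inter_subset_left.trans hLM) (hVL hA)))
  · rw [← Set.disjoint_iff_inter_eq_empty, ← Set.subset_compl_iff_disjoint_right] at hVX
    exact absurd (subset_basicInterior hV hVX hA) (hL (hVL hA))

theorem bp_of_abp {X : Set InfSet} (hX : ABP X) : BP X := by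
  refine ⟨basicInterior X, isOpen_basicInterior X, fun _ => X \ basicInterior X, fun _ => ?_, ?_⟩
  · intro U hU hne
    obtain ⟨V, hV, hVne, hVU, hVX | hVX⟩ := hX U hU hne
    · refine ⟨V, hV, hVne, hVU, Set.eq_empty_of_forall_notMem fun A hA => ?_⟩
      exact hA.2.2 (subset_basicInterior hV hVX hA.1)
    · refine ⟨V, hV, hVne, hVU, Set.eq_empty_of_forall_notMem fun A hA => ?_⟩
      exact Set.eq_empty_iff_forall_notMem.1 hVX A ⟨hA.1, hA.2.1⟩
  · rw [Set.iUnion_const, Set.symmDiff_def,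
      Set.sdiff_eq_empty.2 (basicInterior_subset X), Set.union_empty]

theorem Nwd.exists_cone_disjoint {X : Set InfSet} (hX : Nwd X) (s : Finset ℕ) (N : InfSet) :
    ∃ M : InfSet, M.1 ⊆ N.1 ∧ cone s M.1 ∩ X = ∅ := by
  have habp : ABP X := fun U hU hne =>
    let ⟨V, hV, hVne, hVU, hVX⟩ := hX U hU hne
    ⟨V, hV, hVne, hVU, Or.inr hVX⟩
  obtain ⟨M, hMN, hM | hM⟩ := (isRamsey_iff X).1 (isRamsey_of_abp habp) s N
  · obtain ⟨V, -, ⟨A, hA⟩, hVM, hVX⟩ := hX _ (isBasic_cone s M.2) (cone_nonempty s M.2)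
    exact absurd ⟨hA, hM (hVM hA)⟩ (Set.eq_empty_iff_forall_notMem.1 hVX A)
  · exact ⟨M, hMN, hM⟩

theorem Meager.exists_cone_disjoint {X : Set InfSet} (hX : Meager X) (s : Finset ℕ) (N : InfSet) :
    ∃ M : InfSet, M.1 ⊆ N.1 ∧ cone s M.1 ∩ X = ∅ := by
  obtain ⟨f, hf, rfl⟩ := hX
  have shrink {t : Finset ℕ} {K L : Set ℕ} {Y : Set InfSet}
      (h : L ∩ {n | ∀ y ∈ t, y < n} ⊆ K) (hK : cone t K ∩ Y = ∅) : cone t L ∩ Y = ∅ :=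
    Set.subset_empty_iff.1 ((Set.inter_subset_inter_left _ (cone_mono h)).trans hK.subset)
  obtain ⟨M, hMN, hM⟩ := exists_fusion
    (P := fun t L => ∀ i ∈ Finset.range (t.sup id + 1), cone t L ∩ f i = ∅)
    (fun t K L h hK i hi => shrink h (hK i hi))
    (fun t K => exists_subset_forall_finset (Q := fun i L => cone t L ∩ f i = ∅)
      (fun i K L h => shrink (Set.inter_subset_left.trans h)) _
      (fun i _ => (hf i).exists_cone_disjoint t) K) s N
  refine ⟨M, hMN, Set.eq_empty_of_forall_notMem fun A ⟨hA, hAf⟩ => ?_⟩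
  obtain ⟨i, hi⟩ := Set.mem_iUnion.1 hAf
  obtain ⟨m, hmA, hm⟩ := A.2.exists_gt (max i (s.sup id))
  have hi' : i ∈ Finset.range ((upTo A.1 m).sup id + 1) := by
    rw [Finset.mem_range]
    have : m ≤ (upTo A.1 m).sup id := Finset.le_sup (f := id) (mem_upTo.2 ⟨hmA, le_rfl⟩)
    omega
  refine Set.eq_empty_iff_forall_notMem.1 (hM _ (upTo_subset hA m) i hi') A
    ⟨mem_cone_upTo hA fun y hy => ?_, hi⟩
  have : y ≤ s.sup id := Finset.le_sup (f := id) hy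
  omega

theorem abp_of_bp {X : Set InfSet} (hX : BP X) : ABP X := by
  obtain ⟨O, hO, hmeager⟩ := hX
  refine abp_of_isRamsey ((isRamsey_iff X).2 fun s N => ?_)
  obtain ⟨M, hMN, hM⟩ := hmeager.exists_cone_disjoint s N
  obtain ⟨L, hLM, hL⟩ := (isRamsey_iff O).1 (isRamsey_of_isOpen hO) s M
  have hiff (A : InfSet) (hA : A ∈ cone s L.1) : A ∈ X ↔ A ∈ O := by
    have := Set.eq_empty_iff_forall_notMem.1 hM A
    simp only [Set.mem_inter_iff, Set.mem_symmDiff, not_and] at this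
    have := this (cone_mono (Set.inter_subset_left.trans hLM) hA)
    tauto
  refine ⟨L, hLM.trans hMN, hL.imp (fun h A hA => (hiff A hA).2 (h hA)) fun h => ?_⟩
  exact Set.eq_empty_of_forall_notMem fun A hA =>
    Set.eq_empty_iff_forall_notMem.1 h A ⟨hA.1, (hiff A hA.1).1 hA.2⟩

/-- **Ellentuck's theorem, part 2.** For any `𝒜 ⊆ [ℕ]^ω`, with respect to the
Ellentuck topology: `𝒜` is Ramsey iff `𝒜` has the abstract Baire property iff `𝒜` has the
Baire property. -/
theorem ellentuck_part2 (𝒜 : Set InfSet) :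
    (IsRamsey 𝒜 ↔ ABP 𝒜) ∧ (ABP 𝒜 ↔ BP 𝒜) := by
  exact ⟨⟨abp_of_isRamsey, isRamsey_of_abp⟩, ⟨bp_of_abp, abp_of_bp⟩⟩

end Ellentuck
end

section
/- (Kastanas' theorem.) For any set 𝒜 ⊆ [ℕ]^ω, the following are equivalent: (a) 𝒜 is Ramsey; (b) for all N ∈ [ℕ]^ω and s ∈ [N]^{<ω}, the Kastanas game 𝒥(𝒜,N,s) is determined, i.e. one of the two players has a winning strategy. -/
open scoped Topology

namespace Ellentuck

/-! ### The Kastanas game `𝒥(𝒜, N, s)`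

Player I plays sets `M 0, M 1, … ∈ [ℕ]^ω` and player II answers with pairs
`(nn 0, NN 0), (nn 1, NN 1), …` with `nn k ∈ ℕ` and `NN k ∈ [ℕ]^ω`. -/

/-- `s < n` : `s = ∅` or `max s < n`. -/
def ltAll (s : Finset ℕ) (n : ℕ) : Prop := ∀ m ∈ s, m < n

/-- `N / s = {n ∈ N : s < n}`. -/
def after (N : Set ℕ) (s : Finset ℕ) : Set ℕ := {n ∈ N | ltAll s n}

/-- The moves of player I induced by a strategy `σ` (which sees II's previous moves). -/
def playM (σ : List (ℕ × InfSet) → InfSet) (nn : ℕ → ℕ) (NN : ℕ → InfSet) (k : ℕ) : InfSet :=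
  σ (List.ofFn fun i : Fin k => (nn i.1, NN i.1))

/-- The position through player I's `k`-th move `M k` is legal, i.e. `M 0 ⊆ N/s` and the rules
`nn i ∈ M i`, `NN i ⊆ M i / {nn i}`, `M (i+1) ⊆ NN i` hold for all `i < k`. -/
def LegalThroughI (N : InfSet) (s : Finset ℕ) (M : ℕ → InfSet) (nn : ℕ → ℕ)
    (NN : ℕ → InfSet) (k : ℕ) : Prop :=
  (M 0).1 ⊆ after N.1 s ∧
    ∀ i < k, nn i ∈ (M i).1 ∧ (NN i).1 ⊆ {m ∈ (M i).1 | nn i < m} ∧ (M (i + 1)).1 ⊆ (NN i).1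

/-- The whole play is legal. -/
def LegalPlay (N : InfSet) (s : Finset ℕ) (M : ℕ → InfSet) (nn : ℕ → ℕ)
    (NN : ℕ → InfSet) : Prop :=
  (M 0).1 ⊆ after N.1 s ∧
    ∀ i : ℕ, nn i ∈ (M i).1 ∧ (NN i).1 ⊆ {m ∈ (M i).1 | nn i < m} ∧ (M (i + 1)).1 ⊆ (NN i).1

/-- `σ` is a winning strategy for player I in `𝒥(𝒜,N,s)`: it plays legally as long as II has
played legally, and for every legal play following it the outcome `N∞ = s ∪ {nn k : k ∈ ℕ}`
belongs to `𝒜`. -/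
def IWinning (𝒜 : Set InfSet) (N : InfSet) (s : Finset ℕ)
    (σ : List (ℕ × InfSet) → InfSet) : Prop :=
  (∀ (nn : ℕ → ℕ) (NN : ℕ → InfSet) (k : ℕ),
      (∀ i < k, nn i ∈ (playM σ nn NN i).1 ∧
        (NN i).1 ⊆ {m ∈ (playM σ nn NN i).1 | nn i < m}) →
      LegalThroughI N s (playM σ nn NN) nn NN k) ∧
  (∀ (nn : ℕ → ℕ) (NN : ℕ → InfSet), LegalPlay N s (playM σ nn NN) nn NN →
      ∀ Ninf : InfSet, Ninf.1 = ↑s ∪ Set.range nn → Ninf ∈ 𝒜)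

/-- The integers played by player II following a strategy `τ` (which sees I's moves so far). -/
def playn (τ : List InfSet → ℕ × InfSet) (M : ℕ → InfSet) (k : ℕ) : ℕ :=
  (τ (List.ofFn fun i : Fin (k + 1) => M i.1)).1

/-- The sets played by player II following a strategy `τ`. -/
def playN (τ : List InfSet → ℕ × InfSet) (M : ℕ → InfSet) (k : ℕ) : InfSet :=
  (τ (List.ofFn fun i : Fin (k + 1) => M i.1)).2

/-- `τ` is a winning strategy for player II in `𝒥(𝒜,N,s)`: it plays legally as long as I has
played legally, and for every legal play following it the outcome `N∞` is not in `𝒜`. -/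
def IIWinning (𝒜 : Set InfSet) (N : InfSet) (s : Finset ℕ)
    (τ : List InfSet → ℕ × InfSet) : Prop :=
  (∀ (M : ℕ → InfSet) (k : ℕ), LegalThroughI N s M (playn τ M) (playN τ M) k →
      playn τ M k ∈ (M k).1 ∧ (playN τ M k).1 ⊆ {m ∈ (M k).1 | playn τ M k < m}) ∧
  (∀ M : ℕ → InfSet, LegalPlay N s M (playn τ M) (playN τ M) →
      ∀ Ninf : InfSet, Ninf.1 = ↑s ∪ Set.range (playn τ M) → Ninf ∉ 𝒜)

/-- The elements of `B` above `n`, as an infinite set. -/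
def above (B : InfSet) (n : ℕ) : InfSet :=
  ⟨{m ∈ B.1 | n < m}, by
    refine (B.2.sdiff (Set.finite_Iic n)).mono ?_
    rintro m ⟨hm, hn⟩
    exact ⟨hm, by simpa using hn⟩⟩

theorem initSeg_union_range {s : Finset ℕ} {n : ℕ → ℕ} (hn : ∀ k, ltAll s (n k)) :
    InitSeg s (↑s ∪ Set.range n) := by
  ext x
  simp only [Finset.mem_coe, Set.mem_ofPred_eq, Set.mem_union, Set.mem_range]
  refine ⟨fun hx => ⟨Or.inl hx, Finset.le_max hx⟩, ?_⟩
  rintro ⟨hx | ⟨k, rfl⟩, hle⟩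
  · exact hx
  · rcases s.eq_empty_or_nonempty with rfl | hs
    · simp at hle
    · have hlt := hn k _ (s.max'_mem hs)
      rw [← Finset.coe_max' hs] at hle
      have : n k ≤ s.max' hs := WithBot.coe_le_coe.1 hle
      omega

theorem InitSeg.subset {s : Finset ℕ} {A : Set ℕ} (h : InitSeg s A) : (s : Set ℕ) ⊆ A := by
  intro x hx
  rw [h] at hx
  exact hx.1

/-! ### Fusion -/

section Fusion

variable {S : Type*} {good : S → InfSet → Prop} {R : S → ℕ → S → Prop}

theorem exists_extend_finite (hmono : ∀ (p : S) (B C : InfSet), C.1 ⊆ B.1 → good p B → good p C)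
    (hstep : ∀ (p : S) (B : InfSet) (n : ℕ) (C : InfSet), good p B → n ∈ B.1 → C.1 ⊆ {m ∈ B.1 | n < m} →
      ∃ (q : S) (C' : InfSet), C'.1 ⊆ C.1 ∧ R p n q ∧ good q C')
    {F : Set S} (hF : F.Finite) {B : InfSet} {n : ℕ} (hn : n ∈ B.1)
    (hgood : ∀ p ∈ F, good p B) :
    ∃ (G : Set S) (C : InfSet), G.Finite ∧ C.1 ⊆ {m ∈ B.1 | n < m} ∧
      (∀ p ∈ F, ∃ q ∈ G, R p n q) ∧ ∀ q ∈ G, good q C := by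
  induction F, hF using Set.Finite.induction_on with
  | empty => exact ⟨∅, above B n, Set.finite_empty, subset_rfl, by simp, by simp⟩
  | @insert p F _ _ ih =>
    obtain ⟨G, C, hG, hC, hR, hGC⟩ := ih fun p hp => hgood p (Set.mem_insert_of_mem _ hp)
    obtain ⟨q, C', hC', hq, hqC⟩ := hstep p B n C (hgood p (Set.mem_insert _ _)) hn hC
    refine ⟨insert q G, C', hG.insert q, hC'.trans hC, ?_, ?_⟩
    · rintro r (rfl | hr)
      · exact ⟨q, Set.mem_insert _ _, hq⟩
      · obtain ⟨t, ht, hrt⟩ := hR r hr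
        exact ⟨t, Set.mem_insert_of_mem _ ht, hrt⟩
    · rintro r (rfl | hr)
      · exact hqC
      · exact hmono _ _ _ hC' (hGC r hr)

/-- If every state that is good for `B` can move along each `n ∈ B` to a state that is good for
a subset of any given `C ⊆ B / n`, then there is an infinite `M` such that every increasing
sequence in `M` labels an infinite path of states. -/
theorem exists_fusion_s3 (hmono : ∀ (p : S) (B C : InfSet), C.1 ⊆ B.1 → good p B → good p C)
    (hstep : ∀ (p : S) (B : InfSet) (n : ℕ) (C : InfSet), good p B → n ∈ B.1 → C.1 ⊆ {m ∈ B.1 | n < m} →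
      ∃ (q : S) (C' : InfSet), C'.1 ⊆ C.1 ∧ R p n q ∧ good q C')
    {p₀ : S} {B₀ : InfSet} (h₀ : good p₀ B₀) :
    ∃ M : InfSet, M.1 ⊆ B₀.1 ∧ ∀ n : ℕ → ℕ, StrictMono n → (∀ k, n k ∈ M.1) →
      ∃ p : ℕ → S, p 0 = p₀ ∧ ∀ k, R (p k) (n k) (p (k + 1)) := by
  let T := {x : Set S × InfSet // x.1.Finite ∧ ∀ p ∈ x.1, good p x.2}
  have hinf (B : InfSet) : sInf B.1 ∈ B.1 := Nat.sInf_mem B.2.nonempty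
  have hext : ∀ x : T, ∃ y : T, x.1.1 ⊆ y.1.1 ∧
      y.1.2.1 ⊆ {m ∈ x.1.2.1 | sInf x.1.2.1 < m} ∧
      ∀ p ∈ x.1.1, ∃ q ∈ y.1.1, R p (sInf x.1.2.1) q := by
    rintro ⟨⟨F, B⟩, hF, hgood⟩
    obtain ⟨G, C, hG, hC, hR, hGC⟩ := exists_extend_finite hmono hstep hF (hinf B) hgood
    refine ⟨⟨⟨F ∪ G, C⟩, hF.union hG, ?_⟩, Set.subset_union_left, hC, ?_⟩
    · rintro p (hp | hp)
      · exact hmono _ _ _ (fun m hm => (hC hm).1) (hgood p hp)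
      · exact hGC p hp
    · intro p hp
      obtain ⟨q, hq, hpq⟩ := hR p hp
      exact ⟨q, Or.inr hq, hpq⟩
  choose next hsub hdecr hnext using hext
  let x : ℕ → T := fun k => Nat.rec ⟨⟨{p₀}, B₀⟩, Set.finite_singleton _, by simpa using h₀⟩
    (fun _ y => next y) k
  let m : ℕ → ℕ := fun k => sInf (x k).1.2.1
  have hBanti : Antitone fun k => (x k).1.2.1 :=
    antitone_nat_of_succ_le fun k y hy => (hdecr (x k) hy).1
  have hFmono : Monotone fun k => (x k).1.1 := monotone_nat_of_le_succ fun k => hsub (x k)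
  have hm : StrictMono m := strictMono_nat_of_lt_succ fun k => (hdecr (x k) (hinf _)).2
  refine ⟨⟨Set.range m, Set.infinite_range_of_injective hm.injective⟩, ?_, ?_⟩
  · rintro _ ⟨k, rfl⟩
    exact hBanti (Nat.zero_le k) (hinf _)
  · intro n hn hnm
    choose j hj using hnm
    have hjmono : StrictMono j := fun a b hab => by
      have := hn hab
      rw [← hj a, ← hj b] at this
      exact hm.lt_iff_lt.1 this
    have hq : ∀ i p, ∃ q, p ∈ (x i).1.1 → q ∈ (x (i + 1)).1.1 ∧ R p (m i) q := by
      intro i p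
      by_cases hp : p ∈ (x i).1.1
      · obtain ⟨q, hq, hR⟩ := hnext (x i) p hp
        exact ⟨q, fun _ => ⟨hq, hR⟩⟩
      · exact ⟨p, fun h => absurd h hp⟩
    choose q hq using hq
    let p : ℕ → S := fun k => Nat.rec p₀ (fun i r => q (j i) r) k
    have hp : ∀ k, p k ∈ (x (j k)).1.1 := by
      intro k
      induction k with
      | zero => exact hFmono (Nat.zero_le (j 0)) (Set.mem_singleton p₀)
      | succ k ih => exact hFmono (hjmono (Nat.lt_succ_self k)) (hq _ _ ih).1
    exact ⟨p, rfl, fun k => hj k ▸ (hq _ _ (hp k)).2⟩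

end Fusion

/-! ### Finite positions -/

/-- The list of the first `k` values of `f`. -/
def initial {α : Type*} (f : ℕ → α) (k : ℕ) : List α := List.ofFn fun i : Fin k => f i.1

section Initial

variable {α : Type*}

theorem initial_succ (f : ℕ → α) (k : ℕ) : initial f (k + 1) = initial f k ++ [f k] := by
  rw [initial, List.ofFn_succ_last]
  rfl

theorem initial_congr {f g : ℕ → α} {k : ℕ} (h : ∀ i < k, f i = g i) :
    initial f k = initial g k := by
  simp only [initial]
  congr 1
  funext i
  exact h i i.2

theorem initial_eq_of_append {p : ℕ → List α} {f : ℕ → α} (h₀ : p 0 = [])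
    (h : ∀ k, p (k + 1) = p k ++ [f k]) (k : ℕ) : p k = initial f k := by
  induction k with
  | zero => simp [h₀, initial]
  | succ k ih => rw [h, ih, initial_succ]

/-- Every entry of the position `p` satisfies `P` relative to the entries before it. -/
def Follows (P : List α → α → Prop) (p : List α) : Prop :=
  ∃ (f : ℕ → α) (k : ℕ), p = initial f k ∧ ∀ i < k, P (initial f i) (f i)

theorem Follows.append {P : List α → α → Prop} {p : List α} (h : Follows P p) {a : α}
    (ha : P p a) : Follows P (p ++ [a]) := by
  obtain ⟨f, k, rfl, hf⟩ := h
  have hfa : ∀ i ≤ k, initial (Function.update f k a) i = initial f i := fun i hi =>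
    initial_congr fun j hj => Function.update_of_ne (by omega) _ _
  refine ⟨Function.update f k a, k + 1, ?_, fun i hi => ?_⟩
  · rw [initial_succ, hfa k le_rfl, Function.update_self]
  · rw [hfa i (by omega)]
    rcases Nat.lt_succ_iff_lt_or_eq.1 hi with hi | rfl
    · rw [Function.update_of_ne hi.ne]
      exact hf i hi
    · rwa [Function.update_self]

end Initial

/-! ### Homogeneous sets from winning strategies -/

/-- Membership in `[s, s ∪ M]` is controlled by increasing sequences in `M`. -/
theorem exists_seg_of_sequences {Q : InfSet → Prop} {N : InfSet} {s : Finset ℕ}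
    (hs : (s : Set ℕ) ⊆ N.1) {M : InfSet} (hM : M.1 ⊆ after N.1 s)
    (h : ∀ n : ℕ → ℕ, StrictMono n → (∀ k, n k ∈ M.1) →
      ∀ A : InfSet, A.1 = ↑s ∪ Set.range n → Q A) :
    ∃ M' : InfSet, M'.1 ⊆ N.1 ∧ (s : Set ℕ) ⊆ M'.1 ∧ ∀ A ∈ seg s M', Q A := by
  classical
  refine ⟨⟨↑s ∪ M.1, M.2.mono Set.subset_union_right⟩,
    Set.union_subset hs (hM.trans fun _ hx => hx.1), Set.subset_union_left, ?_⟩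
  rintro A ⟨hAM, hsA⟩
  have hdiff : (A.1 \ ↑s).Infinite := A.2.sdiff s.finite_toSet
  have := hdiff.to_subtype
  have hrange : Set.range (Nat.orderEmbeddingOfSet (A.1 \ ↑s)) = A.1 \ ↑s :=
    Nat.orderEmbeddingOfSet_range _
  refine h _ (Nat.orderEmbeddingOfSet (A.1 \ ↑s)).strictMono (fun k => ?_) A ?_
  · have hk : Nat.orderEmbeddingOfSet (A.1 \ ↑s) k ∈ A.1 \ ↑s :=
      hrange.subset (Set.mem_range_self k)
    exact (hAM hk.1).resolve_left hk.2
  · rw [hrange, Set.union_sdiff_cancel hsA.subset]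

theorem IWinning.exists_seg_subset {𝒜 : Set InfSet} {N : InfSet} {s : Finset ℕ}
    (hs : (s : Set ℕ) ⊆ N.1) {σ : List (ℕ × InfSet) → InfSet} (hσ : IWinning 𝒜 N s σ) :
    ∃ M : InfSet, M.1 ⊆ N.1 ∧ (s : Set ℕ) ⊆ M.1 ∧ ∀ A ∈ seg s M, A ∈ 𝒜 := by
  let P : List (ℕ × InfSet) → ℕ × InfSet → Prop := fun p a =>
    a.1 ∈ (σ p).1 ∧ a.2.1 ⊆ {m ∈ (σ p).1 | a.1 < m}
  have hanswer : ∀ p a, Follows P p → P p a → (σ (p ++ [a])).1 ⊆ a.2.1 := by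
    intro p a hp ha
    obtain ⟨f, k, hfk, hf⟩ := hp.append ha
    obtain ⟨l, rfl⟩ : ∃ l, k = l + 1 := by
      rcases k with _ | l
      · simp [initial] at hfk
      · exact ⟨l, rfl⟩
    have := ((hσ.1 (fun i => (f i).1) (fun i => (f i).2) (l + 1) hf).2 l (by omega)).2.2
    rw [hfk]
    rw [initial_succ] at hfk
    obtain ⟨-, hfl⟩ := List.append_inj' hfk rfl
    rw [List.singleton_inj.1 hfl]
    exact this
  obtain ⟨M, hM, hpath⟩ := exists_fusion_s3
    (good := fun p B => Follows P p ∧ B.1 ⊆ (σ p).1)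
    (R := fun p n q => ∃ C : InfSet, q = p ++ [(n, C)] ∧ P p (n, C))
    (fun p B C hCB h => ⟨h.1, hCB.trans h.2⟩)
    (fun p B n C h hn hC => by
      have hP : P p (n, C) := ⟨h.2 hn, fun m hm => ⟨h.2 (hC hm).1, (hC hm).2⟩⟩
      exact ⟨p ++ [(n, C)], σ (p ++ [(n, C)]), hanswer p _ h.1 hP, ⟨C, rfl, hP⟩,
        h.1.append hP, subset_rfl⟩)
    (p₀ := []) (B₀ := σ []) ⟨⟨fun _ => (0, N), 0, by simp [initial], by simp⟩, subset_rfl⟩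
  refine exists_seg_of_sequences hs (M := M) (hM.trans ?_) ?_
  · exact (hσ.1 (fun _ => 0) (fun _ => N) 0 (by simp)).1
  · intro n hn hnM A hA
    obtain ⟨p, hp₀, hp⟩ := hpath n hn hnM
    choose C hC hP using hp
    have hpk := initial_eq_of_append (f := fun i => (n i, C i)) hp₀ hC
    have hlegal : ∀ i, n i ∈ (playM σ n C i).1 ∧
        (C i).1 ⊆ {m ∈ (playM σ n C i).1 | n i < m} := by
      intro i
      have := hP i
      rw [hpk i] at this
      exact this
    refine hσ.2 n C ⟨(hσ.1 n C 0 (by simp)).1, fun i => ?_⟩ A hA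
    exact (hσ.1 n C (i + 1) fun i _ => hlegal i).2 i (by omega)

/-- If a player answers each infinite `M ⊆ D` by `n ∈ M` and a subset of `M / n`, then every
infinite `C ⊆ D` has an infinite subset `B` such that each `n ∈ B` is an answer to some `M ⊆ C`
where the returned set includes `B / n`. -/
theorem exists_subset_answers {D : Set ℕ} {g : InfSet → ℕ × InfSet}
    (hg : ∀ M : InfSet, M.1 ⊆ D → (g M).1 ∈ M.1 ∧ (g M).2.1 ⊆ {m ∈ M.1 | (g M).1 < m})
    {C : InfSet} (hC : C.1 ⊆ D) :
    ∃ B : InfSet, B.1 ⊆ C.1 ∧ ∀ n ∈ B.1, ∃ M : InfSet, M.1 ⊆ D ∧ (g M).1 = n ∧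
      {m ∈ B.1 | n < m} ⊆ (g M).2.1 := by
  let K : ℕ → InfSet := fun k => Nat.rec C (fun _ M => (g M).2) k
  have hKD : ∀ k, (K k).1 ⊆ D := by
    intro k
    induction k with
    | zero => exact hC
    | succ k ih => exact fun x hx => ih ((hg _ ih).2 hx).1
  have hanti : Antitone fun k => (K k).1 :=
    antitone_nat_of_succ_le fun k x hx => ((hg _ (hKD k)).2 hx).1
  let n : ℕ → ℕ := fun k => (g (K k)).1
  have hnK : ∀ k, n k ∈ (K k).1 := fun k => (hg _ (hKD k)).1
  have hn : StrictMono n :=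
    strictMono_nat_of_lt_succ fun k => ((hg _ (hKD k)).2 (hnK (k + 1))).2
  refine ⟨⟨Set.range n, Set.infinite_range_of_injective hn.injective⟩, ?_, ?_⟩
  · rintro _ ⟨k, rfl⟩
    exact hanti (Nat.zero_le k) (hnK k)
  · rintro _ ⟨k, rfl⟩
    refine ⟨K k, hKD k, rfl, ?_⟩
    rintro _ ⟨⟨l, rfl⟩, hkl⟩
    exact hanti (hn.lt_iff_lt.1 hkl) (hnK l)

theorem IIWinning.exists_seg_disjoint {𝒜 : Set InfSet} {N : InfSet} {s : Finset ℕ}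
    (hs : (s : Set ℕ) ⊆ N.1) {τ : List InfSet → ℕ × InfSet} (hτ : IIWinning 𝒜 N s τ) :
    ∃ M : InfSet, M.1 ⊆ N.1 ∧ (s : Set ℕ) ⊆ M.1 ∧ ∀ A ∈ seg s M, A ∉ 𝒜 := by
  classical
  let D : List InfSet → Set ℕ := fun p => if p = [] then after N.1 s else (τ p).2.1
  let P : List InfSet → InfSet → Prop := fun p M => M.1 ⊆ D p
  have hD₀ (f : ℕ → InfSet) : D (initial f 0) = after N.1 s := if_pos (by simp [initial])
  have hD (f : ℕ → InfSet) (k : ℕ) : D (initial f (k + 1)) = (playN τ f k).1 :=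
    if_neg (by simp [initial])
  have hlegal : ∀ (f : ℕ → InfSet) (k : ℕ), (∀ i ≤ k, P (initial f i) (f i)) →
      playn τ f k ∈ (f k).1 ∧ (playN τ f k).1 ⊆ {m ∈ (f k).1 | playn τ f k < m} := by
    intro f k
    induction k using Nat.strong_induction_on with
    | _ k ih =>
      intro hf
      refine hτ.1 f k ⟨hD₀ f ▸ hf 0 (Nat.zero_le k), fun i hi => ?_⟩
      have := ih i hi fun j hj => hf j (by omega)
      exact ⟨this.1, this.2, hD f i ▸ hf (i + 1) hi⟩
  have hanswer : ∀ p, Follows P p → ∀ M : InfSet, M.1 ⊆ D p →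
      (τ (p ++ [M])).1 ∈ M.1 ∧
        (τ (p ++ [M])).2.1 ⊆ {m ∈ M.1 | (τ (p ++ [M])).1 < m} := by
    intro p hp M hM
    obtain ⟨f, k, hfk, hf⟩ := hp.append (P := P) hM
    obtain ⟨l, rfl⟩ : ∃ l, k = l + 1 := by
      rcases k with _ | l
      · simp [initial] at hfk
      · exact ⟨l, rfl⟩
    have := hlegal f l fun i hi => hf i (by omega)
    rw [hfk]
    rw [initial_succ] at hfk
    obtain ⟨-, hfl⟩ := List.append_inj' hfk rfl
    rw [List.singleton_inj.1 hfl]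
    exact this
  let good : List InfSet → InfSet → Prop := fun p B => Follows P p ∧ ∀ n ∈ B.1, ∃ M : InfSet,
    M.1 ⊆ D p ∧ (τ (p ++ [M])).1 = n ∧ {m ∈ B.1 | n < m} ⊆ (τ (p ++ [M])).2.1
  have hdense : ∀ p, Follows P p → ∀ C : InfSet, C.1 ⊆ D p →
      ∃ B : InfSet, B.1 ⊆ C.1 ∧ good p B := by
    intro p hp C hC
    obtain ⟨B, hBC, hB⟩ := exists_subset_answers (hanswer p hp) hC
    exact ⟨B, hBC, hp, hB⟩
  have hnil : Follows P [] := ⟨fun _ => N, 0, by simp [initial], by simp⟩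
  obtain ⟨B₀, hB₀, hgood₀⟩ := hdense [] hnil
    ⟨after N.1 s, (N.2.sdiff (Set.finite_Iic (s.sup id))).mono fun n hn => ⟨hn.1, fun m hm => by
      have : m ≤ s.sup id := Finset.le_sup (f := id) hm
      have : s.sup id < n := by simpa using hn.2
      omega⟩⟩ (by simp [D])
  obtain ⟨M, hM, hpath⟩ := exists_fusion_s3 (good := good)
    (R := fun p n q => ∃ M : InfSet, q = p ++ [M] ∧ P p M ∧ (τ q).1 = n)
    (fun p B C hCB h => ⟨h.1, fun n hn => by
      obtain ⟨M, hMD, hMn, hBM⟩ := h.2 n (hCB hn)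
      exact ⟨M, hMD, hMn, fun m hm => hBM ⟨hCB hm.1, hm.2⟩⟩⟩)
    (fun p B n C h hn hC => by
      obtain ⟨M, hMD, hMn, hBM⟩ := h.2 n hn
      obtain ⟨C', hC', hgood⟩ := hdense (p ++ [M]) (h.1.append (P := P) hMD) C
        ((hC.trans hBM).trans (if_neg (by simp)).ge)
      exact ⟨p ++ [M], C', hC', ⟨M, rfl, hMD, hMn⟩, hgood⟩)
    hgood₀
  refine exists_seg_of_sequences hs (hM.trans hB₀) ?_
  intro n hn hnM A hA
  obtain ⟨p, hp₀, hp⟩ := hpath n hn hnM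
  choose f hf hP hfn using hp
  have hpk := initial_eq_of_append hp₀ hf
  have hfP : ∀ i, P (initial f i) (f i) := fun i => hpk i ▸ hP i
  have hplayn : playn τ f = n := by
    funext k
    rw [← hfn k, hpk (k + 1)]
    rfl
  refine hτ.2 f ⟨hD₀ f ▸ hfP 0, fun i => ?_⟩ A (by rw [hplayn, hA])
  have := hlegal f i fun j _ => hfP j
  exact ⟨this.1, this.2, hD f i ▸ hfP (i + 1)⟩

/-! ### Winning strategies from homogeneous sets -/

theorem exists_iWinning {𝒜 : Set InfSet} {N X : InfSet} {s : Finset ℕ}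
    (hX : X.1 ⊆ after N.1 s)
    (h : ∀ n : ℕ → ℕ, (∀ k, n k ∈ X.1) → ∀ A : InfSet, A.1 = ↑s ∪ Set.range n → A ∈ 𝒜) :
    ∃ σ : List (ℕ × InfSet) → InfSet, IWinning 𝒜 N s σ := by
  let σ : List (ℕ × InfSet) → InfSet := fun l => (l.getLast?.map Prod.snd).getD X
  have hσ₀ (nn : ℕ → ℕ) (NN : ℕ → InfSet) : playM σ nn NN 0 = X := by simp [playM, σ]
  have hσ (nn : ℕ → ℕ) (NN : ℕ → InfSet) (k : ℕ) : playM σ nn NN (k + 1) = NN k := by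
    rw [playM, List.ofFn_succ_last]
    simp [σ]
  refine ⟨σ, fun nn NN k hk => ⟨by rwa [hσ₀], fun i hi => ?_⟩, fun nn NN hplay => ?_⟩
  · exact ⟨(hk i hi).1, (hk i hi).2, by rw [hσ]⟩
  · have hsub : ∀ k, (playM σ nn NN k).1 ⊆ X.1 := by
      intro k
      induction k with
      | zero => rw [hσ₀]
      | succ k ih => exact fun x hx => ih ((hplay.2 k).2.1 ((hplay.2 k).2.2 hx)).1
    exact h nn fun k => hsub k (hplay.2 k).1

theorem exists_iiWinning {𝒜 : Set InfSet} {N : InfSet} {s : Finset ℕ}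
    (h : ∀ M : InfSet, M.1 ⊆ after N.1 s → ∃ X : InfSet, X.1 ⊆ M.1 ∧
      ∀ n : ℕ → ℕ, (∀ k, n k ∈ X.1) → ∀ A : InfSet, A.1 = ↑s ∪ Set.range n → A ∉ 𝒜) :
    ∃ τ : List InfSet → ℕ × InfSet, IIWinning 𝒜 N s τ := by
  have h' : ∀ M : InfSet, ∃ X : InfSet, M.1 ⊆ after N.1 s → X.1 ⊆ M.1 ∧
      ∀ n : ℕ → ℕ, (∀ k, n k ∈ X.1) → ∀ A : InfSet, A.1 = ↑s ∪ Set.range n → A ∉ 𝒜 := by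
    intro M
    by_cases hM : M.1 ⊆ after N.1 s
    · obtain ⟨X, hX⟩ := h M hM
      exact ⟨X, fun _ => hX⟩
    · exact ⟨M, fun h => absurd h hM⟩
  choose X hX using h'
  let g : InfSet → ℕ × InfSet := fun B => (sInf B.1, above B (sInf B.1))
  have hg (B : InfSet) : (g B).1 ∈ B.1 := Nat.sInf_mem B.2.nonempty
  let τ : List InfSet → ℕ × InfSet := fun l =>
    g (if l.length = 1 then X (l.getLast?.getD N) else l.getLast?.getD N)
  have hτ₀ (M : ℕ → InfSet) : τ (List.ofFn fun i : Fin (0 + 1) => M i.1) = g (X (M 0)) := by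
    simp [τ]
  have hτ (M : ℕ → InfSet) (k : ℕ) :
      τ (List.ofFn fun i : Fin (k + 1 + 1) => M i.1) = g (M (k + 1)) := by
    rw [List.ofFn_succ_last]
    simp [τ, -List.ofFn_succ]
  refine ⟨τ, fun M k hk => ?_, fun M hplay => ?_⟩
  · rcases k with _ | k
    · have hsub := (hX (M 0) hk.1).1
      simp only [playn, playN, hτ₀]
      exact ⟨hsub (hg _), fun m hm => ⟨hsub hm.1, hm.2⟩⟩
    · simp only [playn, playN, hτ]
      exact ⟨hg _, subset_rfl⟩
  · have hn₀ : playn τ M 0 ∈ (X (M 0)).1 := by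
      simp only [playn, hτ₀]
      exact hg _
    have hN₀ : (playN τ M 0).1 ⊆ (X (M 0)).1 := by
      simp only [playN, hτ₀]
      exact fun m hm => hm.1
    have hsub : ∀ k, (M (k + 1)).1 ⊆ (X (M 0)).1 := by
      intro k
      induction k with
      | zero => exact (hplay.2 0).2.2.trans hN₀
      | succ k ih =>
        exact fun x hx => ih ((hplay.2 (k + 1)).2.1 ((hplay.2 (k + 1)).2.2 hx)).1
    refine (hX (M 0) hplay.1).2 _ fun k => ?_
    rcases k with _ | k
    · exact hn₀
    · exact hsub k (hplay.2 (k + 1)).1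

theorem mem_seg_of_eq_union_range {N M A : InfSet} {s : Finset ℕ} (hsM : (s : Set ℕ) ⊆ M.1)
    {n : ℕ → ℕ} (hn : ∀ k, n k ∈ M.1 ∩ after N.1 s) (hA : A.1 = ↑s ∪ Set.range n) :
    A ∈ seg s M := by
  refine ⟨?_, hA ▸ initSeg_union_range fun k => (hn k).2.2⟩
  rw [hA]
  exact Set.union_subset hsM (Set.range_subset_iff.2 fun k => (hn k).1)

theorem IsRamsey.exists_subset {𝒜 : Set InfSet} (h𝒜 : IsRamsey 𝒜) {N M : InfSet}
    {s : Finset ℕ} (hM : M.1 ⊆ after N.1 s) :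
    ∃ X : InfSet, X.1 ⊆ M.1 ∧
      ((∀ n : ℕ → ℕ, (∀ k, n k ∈ X.1) → ∀ A : InfSet, A.1 = ↑s ∪ Set.range n → A ∈ 𝒜) ∨
       ∀ n : ℕ → ℕ, (∀ k, n k ∈ X.1) → ∀ A : InfSet, A.1 = ↑s ∪ Set.range n → A ∉ 𝒜) := by
  obtain ⟨K, hKM, hsK, hK⟩ := h𝒜 ⟨↑s ∪ M.1, M.2.mono Set.subset_union_right⟩ s
    Set.subset_union_left
  have hX : K.1 \ ↑s ⊆ M.1 := fun x hx => (hKM hx.1).resolve_left hx.2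
  refine ⟨⟨K.1 \ ↑s, K.2.sdiff s.finite_toSet⟩, hX, ?_⟩
  have hmem : ∀ n : ℕ → ℕ, (∀ k, n k ∈ K.1 \ (s : Set ℕ)) → ∀ A : InfSet,
      A.1 = ↑s ∪ Set.range n → A ∈ seg s K := fun n hn A hA =>
    mem_seg_of_eq_union_range hsK (fun k => ⟨(hn k).1, hM (hX (hn k))⟩) hA
  refine hK.imp (fun h n hn A hA => h (hmem n hn A hA)) fun h n hn A hA hA𝒜 => ?_
  exact Set.notMem_empty A (h ▸ ⟨hmem n hn A hA, hA𝒜⟩)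

/-- **Kastanas' theorem.** `𝒜 ⊆ [ℕ]^ω` is Ramsey iff for all `N ∈ [ℕ]^ω` and
`s ∈ [N]^{<ω}` the Kastanas game `𝒥(𝒜,N,s)` is determined, i.e. one of the two players has a
winning strategy. -/
theorem kastanas (𝒜 : Set InfSet) :
    IsRamsey 𝒜 ↔
      ∀ (N : InfSet) (s : Finset ℕ), (s : Set ℕ) ⊆ N.1 →
        ((∃ σ : List (ℕ × InfSet) → InfSet, IWinning 𝒜 N s σ) ∨
         (∃ τ : List InfSet → ℕ × InfSet, IIWinning 𝒜 N s τ)) := by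
  constructor
  · intro h𝒜 N s _
    by_cases hI : ∃ X : InfSet, X.1 ⊆ after N.1 s ∧
        ∀ n : ℕ → ℕ, (∀ k, n k ∈ X.1) → ∀ A : InfSet, A.1 = ↑s ∪ Set.range n → A ∈ 𝒜
    · obtain ⟨X, hX, h⟩ := hI
      exact Or.inl (exists_iWinning hX h)
    · refine Or.inr (exists_iiWinning fun M hM => ?_)
      obtain ⟨X, hXM, h | h⟩ := h𝒜.exists_subset hM
      · exact absurd ⟨X, hXM.trans hM, h⟩ hI
      · exact ⟨X, hXM, h⟩
  · intro h N s hs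
    rcases h N s hs with ⟨σ, hσ⟩ | ⟨τ, hτ⟩
    · obtain ⟨M, hMN, hsM, hM⟩ := hσ.exists_seg_subset hs
      exact ⟨M, hMN, hsM, Or.inl hM⟩
    · obtain ⟨M, hMN, hsM, hM⟩ := hτ.exists_seg_disjoint hs
      exact ⟨M, hMN, hsM, Or.inr (Set.eq_empty_of_forall_notMem fun A hA => hM A hA.1 hA.2)⟩

end Ellentuck
end

section
/- (Small Lemma.) Let (ℛ,≤,r) be a strong topological Ramsey space. For each 𝒬 ⊆ ℛ, m ∈ ℕ, A ∈ ℛ, and b,d ∈ 𝒜ℛ, if depth_A(b) ≤ depth_A(d) ≤ m and b ≤_fin d, then there is some B ∈ [m,A] such that either ⟨d,B⟩_m^A ⊆ 𝒮_b^𝒬 or ⟨d,B⟩_m^A ∩ 𝒮_b^𝒬 = ∅. -/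
open scoped Topology

namespace AbstractTRS

/-- A combinatorial structure `(ℛ, ≤, r)`: a quasi-ordered set `R` of objects together with
approximation mappings `r : R → ℕ → α` and a finitization relation `≤_fin` on approximations. -/
structure CombStruct (R : Type) (α : Type) where
  le : R → R → Prop
  le_refl : ∀ A, le A A
  le_trans : ∀ {A B C}, le A B → le B C → le A C
  r : R → ℕ → α
  lefin : α → α → Prop

namespace CombStruct

variable {R α : Type} (S : CombStruct R α)

/-- `𝒜ℛ`, the set of all finite approximations. -/
def AR : Set α := {a | ∃ (A : R) (n : ℕ), S.r A n = a}

/-- `𝒜ℛ_n`, the set of all `n`-approximations. -/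
def ARn (n : ℕ) : Set α := {a | ∃ A : R, S.r A n = a}

/-- `a ⊑ b` : `a` is an initial segment of `b`. -/
def Init (a b : α) : Prop := ∃ (C : R) (n m : ℕ), n ≤ m ∧ S.r C n = a ∧ S.r C m = b

/-- `a ⊏ b` : `a` is a proper initial segment of `b`. -/
def PInit (a b : α) : Prop := S.Init a b ∧ a ≠ b

/-- The basic set `[a, B]`, where `na = |a|` is the length of `a`. -/
def seg (a : α) (na : ℕ) (B : R) : Set R := {X | S.le X B ∧ S.r X na = a}

/-- `[n, B] = [r_n(B), B]`. -/
def segN (n : ℕ) (B : R) : Set R := S.seg (S.r B n) n B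

/-- `depth_B(a) < ∞`. -/
def hasDepth (B : R) (a : α) : Prop := ∃ n, S.lefin a (S.r B n)

/-- `depth_B(a)` : the minimal `n` with `a ≤_fin r_n(B)` (junk value `0` if there is none). -/
noncomputable def depth (B : R) (a : α) : ℕ :=
  letI : DecidablePred fun n => S.lefin a (S.r B n) := Classical.decPred _
  letI : Decidable (∃ n, S.lefin a (S.r B n)) := Classical.dec _
  if h : ∃ n, S.lefin a (S.r B n) then Nat.find h else 0

/-- `r_n''[a,B]`, where `na = |a|`. -/
def rimg (n : ℕ) (a : α) (na : ℕ) (B : R) : Set α :=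
  {d | ∃ D ∈ S.seg a na B, S.r D n = d}

/-- Axioms A.1 (metrization). -/
def A1 : Prop :=
  (∀ A B : R, S.r A 0 = S.r B 0) ∧
  (∀ A B : R, A ≠ B → ∃ n, S.r A n ≠ S.r B n) ∧
  (∀ (A B : R) (n m : ℕ), S.r A n = S.r B m → n = m ∧ ∀ k ≤ n, S.r A k = S.r B k)

/-- Axioms A.2 (finitization): `≤_fin` is a quasi-order on `𝒜ℛ` satisfying A.2.1–A.2.3. -/
def A2 : Prop :=
  (∀ a ∈ S.AR, S.lefin a a) ∧
  (∀ a b c : α, S.lefin a b → S.lefin b c → S.lefin a c) ∧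
  (∀ b : α, {a : α | S.lefin a b}.Finite) ∧
  (∀ A B : R, S.le A B ↔ ∀ n : ℕ, ∃ m : ℕ, S.lefin (S.r A n) (S.r B m)) ∧
  (∀ a b c : α, S.Init a b → S.lefin b c → ∃ d : α, S.Init d c ∧ S.lefin a d)

/-- Axioms A.3 (amalgamation). -/
def A3 : Prop :=
  (∀ (a : α) (na : ℕ), a ∈ S.ARn na → ∀ B : R, S.hasDepth B a →
    ∀ A ∈ S.segN (S.depth B a) B, (S.seg a na A).Nonempty) ∧
  (∀ (a : α) (na : ℕ), a ∈ S.ARn na → ∀ A B : R, S.le A B →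
    S.hasDepth B a → S.hasDepth A a → S.depth A a ≤ S.depth B a →
    ∃ A' ∈ S.segN (S.depth B a) B, S.seg a na A' ⊆ S.seg a na A)

/-- Axiom A.4 (abstract pigeonhole principle). -/
def A4 : Prop :=
  ∀ (a : α) (na : ℕ), a ∈ S.ARn na → ∀ B : R, S.hasDepth B a →
    ∀ O : Set α, O ⊆ S.ARn (na + 1) →
      ∃ A ∈ S.segN (S.depth B a) B,
        S.rimg (na + 1) a na A ⊆ O ∨ O ∩ S.rimg (na + 1) a na A = ∅

/-- `⟨b,B⟩_m^A = {X ∈ [b,B] : depth_A(r_{|b|+1}(X)) > m}`, where `nb = |b|`. -/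
def angle (b : α) (nb : ℕ) (B A : R) (m : ℕ) : Set R :=
  {X | X ∈ S.seg b nb B ∧ (S.hasDepth A (S.r X (nb + 1)) → m < S.depth A (S.r X (nb + 1)))}

/-- Axiom A.3*.1 (first axiom of strong amalgamation). -/
def A3star1 : Prop :=
  ∀ (b : α) (nb : ℕ), b ∈ S.ARn nb → ∀ (A : R) (m : ℕ),
    S.hasDepth A b → S.depth A b ≤ m →
    ∀ B ∈ S.segN m A, (S.angle b nb B A m).Nonempty

/-- Axiom A.3*.2 (second axiom of strong amalgamation). -/
def A3star2 : Prop :=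
  ∀ (b : α) (nb : ℕ), b ∈ S.ARn nb → ∀ (A B : R) (m : ℕ), S.le B A →
    S.hasDepth A b → S.depth A b ≤ m → S.hasDepth B b → S.depth B b ≤ S.depth A b →
    ∃ B' ∈ S.segN m A, S.angle b nb B' A m ⊆ S.angle b nb B A m

/-- Axioms A.3* (strong amalgamation). -/
def A3star : Prop := S.A3star1 ∧ S.A3star2

/-- The structure is metrically closed: `ℛ`, identified with the set of sequences
`(r_n(A))_n`, is closed in `α^ℕ` with `α` discrete. -/
def MetricallyClosed : Prop :=
  @IsClosed (ℕ → α) (@Pi.topologicalSpace ℕ (fun _ => α) (fun _ => ⊥))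
    {f | ∃ A : R, ∀ n, f n = S.r A n}

/-- The basic (open) sets `[a,B]` of the Ellentuck topology. -/
def IsBasic (U : Set R) : Prop :=
  ∃ (a : α) (na : ℕ) (B : R), a ∈ S.ARn na ∧ U = S.seg a na B

/-- The Ellentuck topology on `ℛ`, generated by the basic sets `[a,B]`. -/
def ellentuck : TopologicalSpace R :=
  TopologicalSpace.generateFrom {U | S.IsBasic U}

/-- `(ℛ,≤,r)` is a topological Ramsey space. -/
def IsTRS : Prop := S.MetricallyClosed ∧ S.A1 ∧ S.A2 ∧ S.A3 ∧ S.A4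

/-- `(ℛ,≤,r)` is a strong topological Ramsey space. -/
def IsStrongTRS : Prop := S.MetricallyClosed ∧ S.A1 ∧ S.A2 ∧ S.A3star ∧ S.A4

/-- `𝒳 ⊆ ℛ` is Ramsey. -/
def RamseySet (X : Set R) : Prop :=
  ∀ (a : α) (na : ℕ) (A : R), a ∈ S.ARn na → (S.seg a na A).Nonempty →
    ∃ B ∈ S.seg a na A, S.seg a na B ⊆ X ∨ S.seg a na B ∩ X = ∅

/-- `𝒳 ⊆ ℛ` is Ramsey null. -/
def RamseyNull (X : Set R) : Prop :=
  ∀ (a : α) (na : ℕ) (A : R), a ∈ S.ARn na → (S.seg a na A).Nonempty →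
    ∃ B ∈ S.seg a na A, S.seg a na B ∩ X = ∅

/-- `𝒳` is nowhere dense (with respect to the basis of the Ellentuck topology). -/
def NwdB (X : Set R) : Prop :=
  ∀ U : Set R, S.IsBasic U → U.Nonempty →
    ∃ V : Set R, S.IsBasic V ∧ V.Nonempty ∧ V ⊆ U ∧ V ∩ X = ∅

/-- `𝒳` is meager: a countable union of nowhere dense sets. -/
def MeagerB (X : Set R) : Prop :=
  ∃ f : ℕ → Set R, (∀ i, S.NwdB (f i)) ∧ X = ⋃ i, f i

/-- `𝒳` has the abstract Baire property. -/
def ABP (X : Set R) : Prop :=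
  ∀ U : Set R, S.IsBasic U → U.Nonempty →
    ∃ V : Set R, S.IsBasic V ∧ V.Nonempty ∧ V ⊆ U ∧ (V ⊆ X ∨ V ∩ X = ∅)

/-- `𝒳` has the Baire property: `𝒳 △ 𝒪` is meager for some open set `𝒪`. -/
def BP (X : Set R) : Prop :=
  ∃ O : Set R, IsOpen[S.ellentuck] O ∧ S.MeagerB (symmDiff X O)

/-- `ℛ ↾ H = {A ∈ ℛ : A ≤ H}`. -/
def restrict (H : R) : Set R := {A | S.le A H}

/-- `𝒮_b^𝒬 = {D ∈ ℛ : ∅ ≠ [b,D] ⊆ 𝒬}`, where `nb = |b|`. -/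
def Sb (Q : Set R) (b : α) (nb : ℕ) : Set R :=
  {D | (S.seg b nb D).Nonempty ∧ S.seg b nb D ⊆ Q}

/-- `D∞` is a diagonalization of the sequence `{D_n}` inside `[a,B]`: for every
`b ∈ 𝒜ℛ↾[a,D∞]` (with `|b| = nb`) one has `∅ ≠ [b,D∞] ⊆ [b,D_{n_b}]`,
where `n_b = depth_B(b) - depth_B(a)`. -/
def Diag (a : α) (B : R) (D : ℕ → R) (Dinf : R) : Prop :=
  ∀ (b : α) (nb : ℕ), b ∈ S.ARn nb → S.Init a b → S.hasDepth Dinf b →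
    (S.seg b nb Dinf).Nonempty ∧
    S.seg b nb Dinf ⊆ S.seg b nb (D (S.depth B b - S.depth B a))

/-- The space is selective: decreasing sequences inside nonempty basic sets admit
diagonalizations. -/
def Selective : Prop :=
  ∀ (a : α) (na : ℕ) (B : R), a ∈ S.ARn na → (S.seg a na B).Nonempty →
    ∀ D : ℕ → R, (∀ n, D n ∈ S.seg a na B) → (∀ n, S.le (D (n + 1)) (D n)) →
      ∃ Dinf ∈ S.seg a na B, S.Diag a B D Dinf

/-! ### The abstract Kastanas game `𝒢_{[a₀,B₀]}(𝒳)`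

Player I plays objects `A 0, A 1, A 2, …` (the paper's `A₁, A₂, …`) and player II answers
with basic sets `[ak (k+1), Bk (k+1)]` (the paper's `[a₁,B₁], [a₂,B₂], …`), where
`ak 0 = a₀` and `Bk 0 = B₀`; `na = |a₀|`, so `|ak k| = na + k`. -/

/-- The moves of player I induced by a strategy `σ` (which sees II's previous moves). -/
def playI (σ : List (α × R) → R) (ak : ℕ → α) (Bk : ℕ → R) (k : ℕ) : R :=
  σ (List.ofFn fun i : Fin k => (ak (i.1 + 1), Bk (i.1 + 1)))

/-- Rule for player I's k-th move: `A_{k+1} ∈ [a_k, B_k]`. -/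
def ruleI (na : ℕ) (ak : ℕ → α) (Bk : ℕ → R) (A : ℕ → R) (k : ℕ) : Prop :=
  A k ∈ S.seg (ak k) (na + k) (Bk k)

/-- Rule for player II's k-th move: `a_k ⊏ a_{k+1}`, `|a_{k+1}| = |a_k| + 1` and
`B_{k+1} ∈ [a_{k+1}, A_{k+1}]`. -/
def ruleII (na : ℕ) (ak : ℕ → α) (Bk : ℕ → R) (A : ℕ → R) (k : ℕ) : Prop :=
  (∃ C : R, S.r C (na + k) = ak k ∧ S.r C (na + k + 1) = ak (k + 1)) ∧
  ak k ≠ ak (k + 1) ∧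
  Bk (k + 1) ∈ S.seg (ak (k + 1)) (na + k + 1) (A k)

/-- The outcome `B∞`, determined by `{B∞} = ⋂ₖ [a_k]`, belongs to `X`. -/
def limitMem (na : ℕ) (ak : ℕ → α) (X : Set R) : Prop :=
  ∀ Binf : R, ({Binf} : Set R) = ⋂ k : ℕ, {Y : R | S.r Y (na + k) = ak k} → Binf ∈ X

/-- `σ` is a winning strategy for player I in `𝒢_{[a,B₀]}(𝒳)`: it plays legally at every
legal position consistent with it, and every legal play following it is won by player I. -/
def IWinning (X : Set R) (a : α) (na : ℕ) (B0 : R) (σ : List (α × R) → R) : Prop :=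
  (∀ (ak : ℕ → α) (Bk : ℕ → R), ak 0 = a → Bk 0 = B0 → ∀ k : ℕ,
      (∀ i < k, S.ruleII na ak Bk (playI σ ak Bk) i) →
      S.ruleI na ak Bk (playI σ ak Bk) k) ∧
  (∀ (ak : ℕ → α) (Bk : ℕ → R), ak 0 = a → Bk 0 = B0 →
      (∀ k : ℕ, S.ruleI na ak Bk (playI σ ak Bk) k ∧ S.ruleII na ak Bk (playI σ ak Bk) k) →
      S.limitMem na ak X)

/-- First components of player II's moves induced by a strategy `τ`. -/
def playIIa (a : α) (τ : List R → α × R) (A : ℕ → R) : ℕ → α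
  | 0 => a
  | k + 1 => (τ (List.ofFn fun i : Fin (k + 1) => A i.1)).1

/-- Second components of player II's moves induced by a strategy `τ`. -/
def playIIB (B0 : R) (τ : List R → α × R) (A : ℕ → R) : ℕ → R
  | 0 => B0
  | k + 1 => (τ (List.ofFn fun i : Fin (k + 1) => A i.1)).2

/-- `τ` is a winning strategy for player II in `𝒢_{[a,B₀]}(𝒳)`: it plays legally at every
legal position consistent with it, and every legal play following it is won by player II. -/
def IIWinning (X : Set R) (a : α) (na : ℕ) (B0 : R) (τ : List R → α × R) : Prop :=
  (∀ (A : ℕ → R) (k : ℕ),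
      (∀ i ≤ k, S.ruleI na (playIIa a τ A) (playIIB B0 τ A) A i) →
      (∀ i < k, S.ruleII na (playIIa a τ A) (playIIB B0 τ A) A i) →
      S.ruleII na (playIIa a τ A) (playIIB B0 τ A) A k) ∧
  (∀ A : ℕ → R,
      (∀ k : ℕ, S.ruleI na (playIIa a τ A) (playIIB B0 τ A) A k ∧
        S.ruleII na (playIIa a τ A) (playIIB B0 τ A) A k) →
      ∀ Binf : R,
        ({Binf} : Set R) = ⋂ k : ℕ, {Y : R | S.r Y (na + k) = playIIa a τ A k} →
        Binf ∉ X)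

variable {S}

theorem lefin_depth {B : R} {a : α} (h : S.hasDepth B a) : S.lefin a (S.r B (S.depth B a)) := by
  classical
  have h' : ∃ n, S.lefin a (S.r B n) := h
  rw [depth, dif_pos h']
  exact @Nat.find_spec _ (Classical.decPred _) h'

theorem depth_le {B : R} {a : α} {n : ℕ} (h : S.lefin a (S.r B n)) : S.depth B a ≤ n := by
  have h' : ∃ n, S.lefin a (S.r B n) := ⟨n, h⟩
  rw [depth, dif_pos h']
  exact @Nat.find_min' _ (Classical.decPred _) h' n h

theorem self_mem_segN (m : ℕ) (A : R) : A ∈ S.segN m A := ⟨S.le_refl A, rfl⟩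

theorem A3star1.seg_nonempty (h : S.A3star1) {b : α} {nb : ℕ} (hb : b ∈ S.ARn nb) {A B : R}
    {m : ℕ} (hA : S.hasDepth A b) (hm : S.depth A b ≤ m) (hB : B ∈ S.segN m A) :
    (S.seg b nb B).Nonempty :=
  (h b nb hb A m hA hm B hB).mono fun _ hX => hX.1

/-- An initial segment of an approximation has finite depth, at most that of the approximation. -/
theorem A2.depth_r_le (h : S.A2) (h1 : S.A1) {A C : R} {k n : ℕ} (hkn : k ≤ n)
    (hC : S.hasDepth A (S.r C n)) :
    S.hasDepth A (S.r C k) ∧ S.depth A (S.r C k) ≤ S.depth A (S.r C n) := by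
  obtain ⟨_, ⟨E, i, j, hij, rfl, hEj⟩, hk⟩ :=
    h.2.2.2.2 _ _ _ ⟨C, k, n, hkn, rfl, rfl⟩ (lefin_depth hC)
  obtain ⟨rfl, hE⟩ := h1.2.2 _ _ _ _ hEj
  rw [hE i hij] at hk
  exact ⟨⟨i, hk⟩, (depth_le hk).trans hij⟩

/-- Depth strictly increases along proper initial segments. -/
theorem IsStrongTRS.depth_r_lt_depth_r_succ (hS : S.IsStrongTRS) {A C : R} {n : ℕ}
    (hC : S.hasDepth A (S.r C (n + 1))) :
    S.depth A (S.r C n) < S.depth A (S.r C (n + 1)) := by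
  obtain ⟨-, h1, h2, ⟨h3, -⟩, h4⟩ := hS
  obtain ⟨hn, -⟩ := h2.depth_r_le h1 n.le_succ hC
  by_contra! hle
  obtain ⟨A', hA', hhom⟩ := h4 _ n ⟨C, rfl⟩ A hn
    {c | c ∈ S.ARn (n + 1) ∧ S.hasDepth A c ∧ S.depth A c ≤ S.depth A (S.r C n)}
    fun c hc => hc.1
  rcases hhom with hsub | hdisj
  · obtain ⟨X, hX, hdeep⟩ := h3 _ n ⟨C, rfl⟩ A _ hn le_rfl A' hA'
    obtain ⟨-, hdX, hleX⟩ := hsub ⟨X, hX, rfl⟩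
    exact (hdeep hdX).not_ge hleX
  · obtain ⟨X, hXA', hX⟩ := h3.seg_nonempty ⟨C, rfl⟩ hC hle hA'
    exact Set.eq_empty_iff_forall_notMem.1 hdisj (S.r C (n + 1))
      ⟨⟨⟨C, rfl⟩, hC, hle⟩, X, ⟨hXA', (h1.2.2 _ _ _ _ hX).2 n n.le_succ⟩, hX⟩

/-- The length of an approximation is at most its depth in any object. -/
theorem IsStrongTRS.length_le_depth (hS : S.IsStrongTRS) {A C : R} :
    ∀ {n : ℕ}, S.hasDepth A (S.r C n) → n ≤ S.depth A (S.r C n)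
  | 0, _ => Nat.zero_le _
  | n + 1, h => (hS.length_le_depth (hS.2.2.1.depth_r_le hS.2.1 n.le_succ h).1).trans_lt
      (hS.depth_r_lt_depth_r_succ h)

variable (S)

/-- **Small Lemma.** Let `(ℛ,≤,r)` be a strong topological Ramsey space. For each
`𝒬 ⊆ ℛ`, `m ∈ ℕ`, `A ∈ ℛ` and `b,d ∈ 𝒜ℛ` (of lengths `nb`, `nd`), if
`depth_A(b) ≤ depth_A(d) ≤ m` and `b ≤_fin d`, then there is `B ∈ [m,A]` such that either
`⟨d,B⟩_m^A ⊆ 𝒮_b^𝒬` or `⟨d,B⟩_m^A ∩ 𝒮_b^𝒬 = ∅`. -/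
theorem small_lemma (S : CombStruct R α) (hS : S.IsStrongTRS)
    (Q : Set R) (m : ℕ) (A : R) (b d : α) (nb nd : ℕ)
    (hb : b ∈ S.ARn nb) (hd : d ∈ S.ARn nd)
    (hdb : S.hasDepth A b) (hdd : S.hasDepth A d)
    (h1 : S.depth A b ≤ S.depth A d) (h2 : S.depth A d ≤ m)
    (hfin : S.lefin b d) :
    ∃ B ∈ S.segN m A,
      S.angle d nd B A m ⊆ S.Sb Q b nb ∨ S.angle d nd B A m ∩ S.Sb Q b nb = ∅ := by
  by_cases hne : S.angle d nd A A m ∩ S.Sb Q b nb = ∅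
  · exact ⟨A, self_mem_segN m A, Or.inr hne⟩
  obtain ⟨C, ⟨⟨hCA, hCd⟩, -⟩, -, hCQ⟩ := Set.nonempty_iff_ne_empty.2 hne
  have hdC : S.lefin d (S.r C nd) := hCd ▸ hS.2.2.1.1 _ ⟨C, nd, rfl⟩
  have hlen : nd ≤ S.depth A d := by
    subst hCd
    exact hS.length_le_depth hdd
  obtain ⟨B, hB, hBC⟩ := hS.2.2.2.1.2 d nd hd A C m hCA hdd h2 ⟨nd, hdC⟩
    ((depth_le hdC).trans hlen)
  refine ⟨B, hB, Or.inl fun X hX => ?_⟩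
  obtain ⟨⟨hXC, hXd⟩, -⟩ := hBC hX
  have hbX : S.hasDepth X b := ⟨nd, hXd.symm ▸ hfin⟩
  exact ⟨hS.2.2.2.1.1.seg_nonempty hb hbX le_rfl (self_mem_segN _ X),
    fun Y hY => hCQ ⟨S.le_trans hY.1 hXC, hY.2⟩⟩

end CombStruct
end AbstractTRS
end
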